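/- arXiv:2310.06596 — 7 statements merged into one kernel-verified Lean document; each statement's English description precedes it below -/
import Mathlib

section
/- Let n ≥ 2 and let 𝕄 = ℝ × ℝⁿ be (n+1)-dimensional Minkowski spacetime with the causal order ⪯. Let M ⊆ 𝕄 be a closed and bounded (hence compact) set, and let x, y ∈ 𝕄 be two points with x ∉ J(M) and y ∉ J(M). Then there exists a bounded, open, causally convex region R ⊆ 𝕄 such that x ∈ R, y ∈ R, and R ∩ J(M) = ∅. -/
/-- Minkowski spacetime `ℝ × ℝⁿ`: time component `p.1`, spatial component `p.2`. -/
abbrev Mink (n : ℕ) := ℝ × EuclideanSpace ℝ (Fin n)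

/-- The causal order `p ⪯ q` iff `‖q.2 - p.2‖ ≤ q.1 - p.1`. -/
def causalLe {n : ℕ} (p q : Mink n) : Prop := ‖q.2 - p.2‖ ≤ q.1 - p.1

/-- Causal future `J⁺(S)`. -/
def Jplus {n : ℕ} (S : Set (Mink n)) : Set (Mink n) := {q | ∃ p ∈ S, causalLe p q}

/-- Causal past `J⁻(S)`. -/
def Jminus {n : ℕ} (S : Set (Mink n)) : Set (Mink n) := {q | ∃ p ∈ S, causalLe q p}

/-- `J(S) = J⁺(S) ∪ J⁻(S)`. -/
def Jset {n : ℕ} (S : Set (Mink n)) : Set (Mink n) := Jplus S ∪ Jminus S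

/-- A set is causally convex iff it contains every causal interval between its points. -/
def CausallyConvex {n : ℕ} (R : Set (Mink n)) : Prop :=
  ∀ p ∈ R, ∀ q ∈ R, ∀ z : Mink n, causalLe p z → causalLe z q → z ∈ R

open Pointwise in
theorem isClosed_Jplus {n : ℕ} {S : Set (Mink n)} (hS : IsCompact S) : IsClosed (Jplus S) := by
  have hcone : IsClosed {v : Mink n | ‖v.2‖ ≤ v.1} :=
    isClosed_le (by fun_prop) (by fun_prop)
  convert hcone.add_left_of_isCompact hS using 1
  ext q
  rw [Set.mem_add]
  constructor
  · rintro ⟨p, hp, hpq⟩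
    exact ⟨p, hp, q - p, hpq, by abel⟩
  · rintro ⟨p, hp, v, hv, rfl⟩
    exact ⟨p, hp, by simpa [causalLe] using hv⟩

open Pointwise in
theorem isClosed_Jminus {n : ℕ} {S : Set (Mink n)} (hS : IsCompact S) : IsClosed (Jminus S) := by
  have hcone : IsClosed {v : Mink n | ‖v.2‖ ≤ -v.1} :=
    isClosed_le (by fun_prop) (by fun_prop)
  convert hcone.add_left_of_isCompact hS using 1
  ext q
  rw [Set.mem_add]
  constructor
  · rintro ⟨p, hp, hqp⟩
    refine ⟨p, hp, q - p, ?_, by abel⟩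
    simpa [causalLe, norm_sub_rev] using hqp
  · rintro ⟨p, hp, v, hv, rfl⟩
    exact ⟨p, hp, by simpa [causalLe] using hv⟩

theorem causalLe.trans {n : ℕ} {p q r : Mink n} (hpq : causalLe p q) (hqr : causalLe q r) :
    causalLe p r := by
  unfold causalLe at *
  linarith [norm_sub_le_norm_sub_add_norm_sub r.2 q.2 p.2]

theorem causallyConvex_compl_Jset {n : ℕ} (S : Set (Mink n)) : CausallyConvex (Jset S)ᶜ := by
  rintro p hp q hq z hpz hzq (⟨m, hm, hmz⟩ | ⟨m, hm, hzm⟩)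
  · exact hq (Or.inl ⟨m, hm, hmz.trans hzq⟩)
  · exact hp (Or.inr ⟨m, hm, hpz.trans hzm⟩)

theorem CausallyConvex.inter {n : ℕ} {R R' : Set (Mink n)} (h : CausallyConvex R)
    (h' : CausallyConvex R') : CausallyConvex (R ∩ R') :=
  fun p hp q hq z hpz hzq => ⟨h p hp.1 q hq.1 z hpz hzq, h' p hp.2 q hq.2 z hpz hzq⟩

/-- The open double cone of radius `T` centred at the origin. -/
def doubleCone (n : ℕ) (T : ℝ) : Set (Mink n) := {z | ‖z.2‖ + |z.1| < T}

theorem isOpen_doubleCone (n : ℕ) (T : ℝ) : IsOpen (doubleCone n T) :=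
  isOpen_lt (by fun_prop) continuous_const

theorem isBounded_doubleCone (n : ℕ) (T : ℝ) : Bornology.IsBounded (doubleCone n T) := by
  refine isBounded_iff_forall_norm_le.2 ⟨T, fun z (hz : ‖z.2‖ + |z.1| < T) => ?_⟩
  rw [Prod.norm_def, Real.norm_eq_abs]
  exact max_le (by linarith [norm_nonneg z.2]) (by linarith [abs_nonneg z.1])

theorem causallyConvex_doubleCone (n : ℕ) (T : ℝ) : CausallyConvex (doubleCone n T) := by
  intro p (hp : ‖p.2‖ + |p.1| < T) q (hq : ‖q.2‖ + |q.1| < T) z hpz hzq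
  unfold causalLe at hpz hzq
  have hz : |z.1| < T - ‖z.2‖ := abs_lt.2
    ⟨by linarith [norm_sub_norm_le z.2 q.2, norm_sub_rev z.2 q.2, neg_abs_le q.1, le_abs_self q.1,
        norm_sub_norm_le z.2 p.2, neg_abs_le p.1],
      by linarith [norm_sub_norm_le z.2 q.2, norm_sub_rev z.2 q.2, le_abs_self q.1]⟩
  change ‖z.2‖ + |z.1| < T
  linarith

theorem stmt0 {n : ℕ} (hn : 2 ≤ n) (M : Set (Mink n))
    (hMclosed : IsClosed M) (hMbounded : Bornology.IsBounded M)
    (x y : Mink n) (hx : x ∉ Jset M) (hy : y ∉ Jset M) :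
    ∃ R : Set (Mink n), Bornology.IsBounded R ∧ IsOpen R ∧ CausallyConvex R ∧
      x ∈ R ∧ y ∈ R ∧ R ∩ Jset M = ∅ := by
  have hM : IsCompact M := Metric.isCompact_of_isClosed_isBounded hMclosed hMbounded
  have hJ : IsClosed (Jset M) := (isClosed_Jplus hM).union (isClosed_Jminus hM)
  obtain ⟨T, hT⟩ := exists_gt (max (‖x.2‖ + |x.1|) (‖y.2‖ + |y.1|))
  obtain ⟨hxT, hyT⟩ := max_lt_iff.1 hT
  refine ⟨doubleCone n T ∩ (Jset M)ᶜ, (isBounded_doubleCone n T).subset Set.inter_subset_left,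
    (isOpen_doubleCone n T).inter hJ.isOpen_compl,
    (causallyConvex_doubleCone n T).inter (causallyConvex_compl_Jset M), ⟨hxT, hx⟩, ⟨hyT, hy⟩, ?_⟩
  rw [Set.inter_assoc, Set.compl_inter_self, Set.inter_empty]
end

section
/- Let n ≥ 1 and let 𝕄 = ℝ × ℝⁿ be Minkowski spacetime with the causal order ⪯. Let M ⊆ 𝕄 be a closed and bounded set, and let x, y ∈ 𝕄 satisfy x ∉ J(M), y ∉ J(M), and y ⪯ x (the points are causally related). Then there exists a bounded, open, causally convex region R ⊆ 𝕄 with x ∈ R, y ∈ R, and R ∩ J(M) = ∅; in fact one may take R = J⁻(O_x) ∩ J⁺(O_y) for sufficiently small open balls O_x around x and O_y around y. -/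
open scoped Pointwise in
theorem Jplus_eq_add {n : ℕ} (S : Set (Mink n)) :
    Jplus S = S + {v : Mink n | ‖v.2‖ ≤ v.1} := by
  ext q
  simp only [Jplus, causalLe, Set.mem_add, Set.mem_ofPred_eq]
  constructor
  · rintro ⟨p, hp, h⟩
    exact ⟨p, hp, q - p, h, add_sub_cancel p q⟩
  · rintro ⟨p, hp, v, hv, rfl⟩
    exact ⟨p, hp, by simpa using hv⟩

open scoped Pointwise in
theorem Jminus_eq_add {n : ℕ} (S : Set (Mink n)) :
    Jminus S = S + {v : Mink n | ‖v.2‖ ≤ -v.1} := by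
  ext q
  simp only [Jminus, causalLe, Set.mem_add, Set.mem_ofPred_eq]
  constructor
  · rintro ⟨p, hp, h⟩
    exact ⟨p, hp, q - p, by simpa [norm_sub_rev] using h, add_sub_cancel p q⟩
  · rintro ⟨p, hp, v, hv, rfl⟩
    exact ⟨p, hp, by simpa using hv⟩

theorem isOpen_Jplus {n : ℕ} {S : Set (Mink n)} (hS : IsOpen S) : IsOpen (Jplus S) := by
  rw [Jplus_eq_add]
  exact hS.add_right

theorem isOpen_Jminus {n : ℕ} {S : Set (Mink n)} (hS : IsOpen S) : IsOpen (Jminus S) := by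
  rw [Jminus_eq_add]
  exact hS.add_right

theorem isClosed_Jset {n : ℕ} {S : Set (Mink n)} (hS : IsCompact S) : IsClosed (Jset S) := by
  rw [Jset, Jplus_eq_add, Jminus_eq_add]
  exact (IsClosed.add_left_of_isCompact
      (isClosed_le continuous_snd.norm continuous_fst) hS).union
    (IsClosed.add_left_of_isCompact
      (isClosed_le continuous_snd.norm continuous_fst.neg) hS)

theorem causalLe_refl {n : ℕ} (p : Mink n) : causalLe p p := by
  simp [causalLe]

theorem causallyConvex_Jminus_inter_Jplus {n : ℕ} (S T : Set (Mink n)) :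
    CausallyConvex (Jminus S ∩ Jplus T) := by
  rintro p ⟨-, b, hb, hbp⟩ q ⟨⟨a, ha, hqa⟩, -⟩ z hpz hzq
  exact ⟨⟨a, ha, hzq.trans hqa⟩, ⟨b, hb, hbp.trans hpz⟩⟩

theorem isBounded_Jminus_ball_inter_Jplus_ball {n : ℕ} (x y : Mink n) (r s : ℝ) :
    Bornology.IsBounded (Jminus (Metric.ball x r) ∩ Jplus (Metric.ball y s)) := by
  refine (Metric.isBounded_closedBall (x := y) (r := x.1 - y.1 + r + 2 * s)).subset ?_
  rintro z ⟨⟨a, ha, hza⟩, b, hb, hbz⟩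
  rw [Metric.mem_ball, Prod.dist_eq, max_lt_iff, Real.dist_eq, abs_lt] at ha hb
  have hzb : ‖z.2 - b.2‖ ≤ z.1 - b.1 := hbz
  have haz : ‖a.2 - z.2‖ ≤ a.1 - z.1 := hza
  have h_tri := dist_triangle z.2 b.2 y.2
  rw [dist_eq_norm z.2 b.2] at h_tri
  have h₁ := norm_nonneg (z.2 - b.2)
  have h₂ := norm_nonneg (a.2 - z.2)
  have h₃ : 0 ≤ dist b.2 y.2 := dist_nonneg
  rw [Metric.mem_closedBall, Prod.dist_eq, max_le_iff, Real.dist_eq, abs_le]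
  refine ⟨⟨?_, ?_⟩, ?_⟩ <;> linarith [ha.1.1, ha.1.2, hb.1.1, hb.1.2, hb.2]

theorem Jminus_inter_Jplus_inter_Jset_eq_empty {n : ℕ} {M S T : Set (Mink n)}
    (hS : S ⊆ (Jset M)ᶜ) (hT : T ⊆ (Jset M)ᶜ) : Jminus S ∩ Jplus T ∩ Jset M = ∅ := by
  rw [Set.eq_empty_iff_forall_notMem]
  rintro z ⟨⟨⟨a, ha, hza⟩, b, hb, hbz⟩, ⟨m, hm, hmz⟩ | ⟨m, hm, hzm⟩⟩
  · exact hS ha (Or.inl ⟨m, hm, hmz.trans hza⟩)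
  · exact hT hb (Or.inr ⟨m, hm, hbz.trans hzm⟩)


theorem stmt1 {n : ℕ} (hn : 1 ≤ n) (M : Set (Mink n))
    (hMclosed : IsClosed M) (hMbounded : Bornology.IsBounded M)
    (x y : Mink n) (hx : x ∉ Jset M) (hy : y ∉ Jset M) (hyx : causalLe y x) :
    ∃ εx > (0 : ℝ), ∃ εy > (0 : ℝ),
      Jminus (Metric.ball x εx) ∩ Jplus (Metric.ball y εy) ∩ Jset M = ∅ ∧
      x ∈ Jminus (Metric.ball x εx) ∩ Jplus (Metric.ball y εy) ∧
      y ∈ Jminus (Metric.ball x εx) ∩ Jplus (Metric.ball y εy) ∧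
      Bornology.IsBounded (Jminus (Metric.ball x εx) ∩ Jplus (Metric.ball y εy)) ∧
      IsOpen (Jminus (Metric.ball x εx) ∩ Jplus (Metric.ball y εy)) ∧
      CausallyConvex (Jminus (Metric.ball x εx) ∩ Jplus (Metric.ball y εy)) := by
  have hJ : IsOpen (Jset M)ᶜ :=
    (isClosed_Jset (Metric.isCompact_of_isClosed_isBounded hMclosed hMbounded)).isOpen_compl
  obtain ⟨r, hr, hxr⟩ := Metric.isOpen_iff.mp hJ x hx
  obtain ⟨s, hs, hys⟩ := Metric.isOpen_iff.mp hJ y hy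
  have hxx := Metric.mem_ball_self (x := x) hr
  have hyy := Metric.mem_ball_self (x := y) hs
  exact ⟨r, hr, s, hs, Jminus_inter_Jplus_inter_Jset_eq_empty hxr hys,
    ⟨⟨x, hxx, causalLe_refl x⟩, ⟨y, hyy, hyx⟩⟩,
    ⟨⟨x, hxx, hyx⟩, ⟨y, hyy, causalLe_refl y⟩⟩,
    isBounded_Jminus_ball_inter_Jplus_ball x y r s,
    (isOpen_Jminus Metric.isOpen_ball).inter (isOpen_Jplus Metric.isOpen_ball),
    causallyConvex_Jminus_inter_Jplus _ _⟩
end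

section
/- On Minkowski spacetime 𝕄 = ℝ × ℝⁿ with the causal order ⪯, if M ⊆ 𝕄 is compact then J⁺(M), J⁻(M), and hence J(M) = J⁺(M) ∪ J⁻(M), are closed subsets of 𝕄. -/
/-- The section of a closed relation over a compact set is closed. -/
theorem IsCompact.isClosed_setOf_exists_mem {X Y : Type*} [TopologicalSpace X]
    [TopologicalSpace Y] {K : Set X} (hK : IsCompact K) {r : X → Y → Prop}
    (hr : IsClosed {z : X × Y | r z.1 z.2}) : IsClosed {y | ∃ x ∈ K, r x y} := by
  have : CompactSpace K := isCompact_iff_compactSpace.mp hK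
  have hcl : IsClosed {z : K × Y | r z.1 z.2} :=
    hr.preimage (f := fun z : K × Y => ((z.1 : X), z.2)) (by fun_prop)
  convert isClosedMap_snd_of_compactSpace _ hcl using 1
  ext y
  simp

theorem stmt8 {n : ℕ} (M : Set (Mink n)) (hM : IsCompact M) :
    IsClosed (Jplus M) ∧ IsClosed (Jminus M) ∧ IsClosed (Jset M) := by
  have hplus : IsClosed (Jplus M) := hM.isClosed_setOf_exists_mem <|
    isClosed_le (f := fun z : Mink n × Mink n => ‖z.2.2 - z.1.2‖)
      (g := fun z => z.2.1 - z.1.1) (by fun_prop) (by fun_prop)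
  have hminus : IsClosed (Jminus M) :=
    hM.isClosed_setOf_exists_mem (r := fun p q => causalLe q p) <|
      isClosed_le (f := fun z : Mink n × Mink n => ‖z.1.2 - z.2.2‖)
        (g := fun z => z.1.1 - z.2.1) (by fun_prop) (by fun_prop)
  exact ⟨hplus, hminus, hplus.union hminus⟩
end

section
/- Let d ≥ 1, let γ : Fin d → ℂ satisfy γ i ≠ 0 for every i and ∑ᵢ ‖γ i‖² = 1, and let Γ be a d × d complex matrix. Suppose that for every d × d complex matrix L one has ∑_{i,j} conj(γ i) · (γ j) · (Γ i j) · (L i j) = (∑ᵢ ‖γ i‖² · Γ i i) · (∑ᵢ ‖γ i‖² · L i i). Then Γ is a scalar multiple of the identity matrix: there exists c ∈ ℂ with Γ = c • 1. -/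
theorem stmt10 {d : ℕ} (hd : 1 ≤ d) (γ : Fin d → ℂ) (hγ : ∀ i, γ i ≠ 0)
    (hnorm : ∑ i, ‖γ i‖ ^ 2 = 1) (Γ : Matrix (Fin d) (Fin d) ℂ)
    (h : ∀ L : Matrix (Fin d) (Fin d) ℂ,
      ∑ i, ∑ j, (starRingEnd ℂ) (γ i) * γ j * Γ i j * L i j =
        (∑ i, (‖γ i‖ ^ 2 : ℂ) * Γ i i) * (∑ i, (‖γ i‖ ^ 2 : ℂ) * L i i)) :
    ∃ c : ℂ, Γ = c • (1 : Matrix (Fin d) (Fin d) ℂ) := by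
  refine ⟨∑ i, (‖γ i‖ ^ 2 : ℂ) * Γ i i, ?_⟩
  ext a b
  have hab := h (Matrix.single a b 1)
  have hleft : ∑ i, ∑ j, (starRingEnd ℂ) (γ i) * γ j * Γ i j *
      Matrix.single a b (1 : ℂ) i j = (starRingEnd ℂ) (γ a) * γ b * Γ a b := by
    simp [Matrix.single_apply, ite_and]
  rw [hleft] at hab
  have hne : (starRingEnd ℂ) (γ a) * γ b ≠ 0 :=
    mul_ne_zero ((map_ne_zero _).2 (hγ a)) (hγ b)
  apply mul_left_cancel₀ hne
  rw [hab, Matrix.smul_apply, smul_eq_mul, mul_left_comm]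
  congr 1
  obtain rfl | hneq := eq_or_ne a b
  · simp [Matrix.single_apply, Complex.conj_mul']
  · rw [Matrix.one_apply_ne hneq, mul_zero]
    refine Finset.sum_eq_zero fun i _ => ?_
    rw [Matrix.single_apply, if_neg, mul_zero]
    rintro ⟨rfl, rfl⟩
    exact hneq rfl
end

section
/- Let d ≤ m, let A be a d × m complex matrix of rank d with trace(A Aᴴ) = 1, and let Γ be a d × d complex matrix. Then the following are equivalent: (i) for every m × m complex matrix L, trace(Γ · A · L · Aᴴ) = trace(Γ · A · Aᴴ) · trace(A · L · Aᴴ); (ii) there exists c ∈ ℂ such that Γ = c • 1. -/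
open Matrix

theorem Matrix.isUnit_of_rank_eq_card {n K : Type*} [Fintype n] [DecidableEq n] [Field K]
    {A : Matrix n n K} (h : A.rank = Fintype.card n) : IsUnit A := by
  rw [← linearIndependent_rows_iff_isUnit, linearIndependent_iff_card_eq_finrank_span, ← h,
    rank_eq_finrank_span_row, Set.finrank]

open scoped ComplexOrder in
theorem Matrix.isUnit_det_self_mul_conjTranspose {m n : Type*} [Fintype m] [DecidableEq m]
    [Fintype n] {A : Matrix m n ℂ} (h : A.rank = Fintype.card m) : IsUnit (A * Aᴴ).det :=
  (isUnit_iff_isUnit_det _).1 <| isUnit_of_rank_eq_card <| by rw [rank_self_mul_conjTranspose, h]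

theorem stmt11 {d m : ℕ} (hdm : d ≤ m) (A : Matrix (Fin d) (Fin m) ℂ)
    (hrank : A.rank = d) (htr : (A * Aᴴ).trace = 1)
    (Γ : Matrix (Fin d) (Fin d) ℂ) :
    (∀ L : Matrix (Fin m) (Fin m) ℂ,
      (Γ * A * L * Aᴴ).trace = (Γ * A * Aᴴ).trace * (A * L * Aᴴ).trace) ↔
    ∃ c : ℂ, Γ = c • (1 : Matrix (Fin d) (Fin d) ℂ) := by
  constructor
  · intro h
    refine ⟨(Γ * A * Aᴴ).trace, ext_iff_trace_mul_right.2 fun Y => ?_⟩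
    have hG : IsUnit (A * Aᴴ).det :=
      isUnit_det_self_mul_conjTranspose (by rw [hrank, Fintype.card_fin])
    have hY : A * (Aᴴ * (A * Aᴴ)⁻¹ * Y * ((A * Aᴴ)⁻¹ * A)) * Aᴴ = Y := by
      calc _ = A * Aᴴ * (A * Aᴴ)⁻¹ * Y * ((A * Aᴴ)⁻¹ * (A * Aᴴ)) := by
            simp only [Matrix.mul_assoc]
        _ = Y := by rw [mul_nonsing_inv _ hG, nonsing_inv_mul _ hG, Matrix.one_mul, Matrix.mul_one]
    have hL := h (Aᴴ * (A * Aᴴ)⁻¹ * Y * ((A * Aᴴ)⁻¹ * A))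
    rw [hY, Matrix.mul_assoc Γ A, Matrix.mul_assoc Γ, hY] at hL
    rw [hL, Matrix.smul_mul, Matrix.one_mul, trace_smul, smul_eq_mul]
  · rintro ⟨c, rfl⟩ L
    simp only [Matrix.smul_mul, Matrix.one_mul, trace_smul, htr, smul_eq_mul, mul_one]
end

section
/- Let d ≥ 1, let γ : Fin d → ℂ satisfy γ i ≠ 0 for every i and ∑ᵢ ‖γ i‖² = 1, let Γₐ be a d × d complex matrix, let β : Fin d → ℂᵉ be unit vectors, and let Γ_b be an e × e complex matrix. Suppose that for every d × d complex matrix L one has ∑_{i,j} conj(γ i) · (γ j) · (Γₐ i j) · ⟪β i, Γ_b (β j)⟫ · (L i j) = (∑ᵢ ‖γ i‖² · (Γₐ i i) · ⟪β i, Γ_b (β i)⟫) · (∑ᵢ ‖γ i‖² · L i i). Then there exists c ∈ ℂ such that for all i, j: (Γₐ i j) · ⟪β i, Γ_b (β j)⟫ = c if i = j, and (Γₐ i j) · ⟪β i, Γ_b (β j)⟫ = 0 if i ≠ j. -/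
open scoped InnerProductSpace

theorem stmt13 {d e : ℕ} (hd : 1 ≤ d) (γ : Fin d → ℂ) (hγ : ∀ i, γ i ≠ 0)
    (hnorm : ∑ i, ‖γ i‖ ^ 2 = 1)
    (Γa : Matrix (Fin d) (Fin d) ℂ)
    (β : Fin d → EuclideanSpace ℂ (Fin e)) (hβ : ∀ i, ‖β i‖ = 1)
    (Γb : Matrix (Fin e) (Fin e) ℂ)
    (h : ∀ L : Matrix (Fin d) (Fin d) ℂ,
      ∑ i, ∑ j, (starRingEnd ℂ) (γ i) * γ j * Γa i j *
          ⟪β i, Matrix.toEuclideanLin Γb (β j)⟫_ℂ * L i j =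
        (∑ i, (‖γ i‖ ^ 2 : ℂ) * Γa i i * ⟪β i, Matrix.toEuclideanLin Γb (β i)⟫_ℂ) *
          (∑ i, (‖γ i‖ ^ 2 : ℂ) * L i i)) :
    ∃ c : ℂ, ∀ i j, Γa i j * ⟪β i, Matrix.toEuclideanLin Γb (β j)⟫_ℂ =
      if i = j then c else 0 := by
  refine ⟨∑ i, (‖γ i‖ ^ 2 : ℂ) * Γa i i * ⟪β i, Matrix.toEuclideanLin Γb (β i)⟫_ℂ,
    fun i j => ?_⟩
  have key := h (Matrix.single i j 1)
  simp only [Matrix.single_apply, ite_and, mul_ite, mul_one, mul_zero, Finset.sum_ite_eq,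
    Finset.sum_ite_irrel, Finset.sum_const_zero, Finset.mem_univ, if_true] at key
  have hne : (starRingEnd ℂ) (γ i) * γ j ≠ 0 :=
    mul_ne_zero ((map_ne_zero _).mpr (hγ i)) (hγ j)
  apply mul_left_cancel₀ hne
  rw [← mul_assoc, key]
  split_ifs with hij hji hji
  · subst hij
    rw [Complex.conj_mul', mul_comm]
  · exact absurd hij.symm hji
  · exact absurd hji.symm hij
  · simp
end

section
/- Let σ be a d × d complex matrix with trace σ = 1, let ρ be an m × m complex matrix, let U be a unitary (d·m) × (d·m) matrix (indexed by Fin d × Fin m), let M : Fin k → Matrix (Fin d) (Fin d) ℂ satisfy the completeness relation ∑ₐ (M a)ᴴ * (M a) = 1, and let L be an m × m complex matrix such that U commutes with 1 ⊗ₖ L. Then ∑ₐ trace( ((M a) ⊗ₖ 1) * U * (σ ⊗ₖ ρ) * Uᴴ * ((M a)ᴴ ⊗ₖ 1) * (1 ⊗ₖ L) ) = trace σ · trace (ρ * L). -/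
open Matrix Kronecker

theorem sum_kronecker {ι l m n p R : Type*} [NonUnitalNonAssocSemiring R] (s : Finset ι)
    (A : ι → Matrix l m R) (B : Matrix n p R) :
    (∑ i ∈ s, A i) ⊗ₖ B = ∑ i ∈ s, A i ⊗ₖ B := by
  ext
  simp [Matrix.sum_apply, Finset.sum_mul]

theorem stmt16 {d m k : ℕ} (σ : Matrix (Fin d) (Fin d) ℂ) (hσ : σ.trace = 1)
    (ρ : Matrix (Fin m) (Fin m) ℂ)
    (U : Matrix (Fin d × Fin m) (Fin d × Fin m) ℂ)
    (hU : U * Uᴴ = 1) (hU' : Uᴴ * U = 1)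
    (M : Fin k → Matrix (Fin d) (Fin d) ℂ)
    (hM : ∑ a, (M a)ᴴ * M a = 1)
    (L : Matrix (Fin m) (Fin m) ℂ)
    (hcomm : Commute U ((1 : Matrix (Fin d) (Fin d) ℂ) ⊗ₖ L)) :
    ∑ a, ((M a ⊗ₖ (1 : Matrix (Fin m) (Fin m) ℂ)) * U * (σ ⊗ₖ ρ) * Uᴴ *
        ((M a)ᴴ ⊗ₖ (1 : Matrix (Fin m) (Fin m) ℂ)) *
        ((1 : Matrix (Fin d) (Fin d) ℂ) ⊗ₖ L)).trace =
      σ.trace * (ρ * L).trace := by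
  have term_eq (a : Fin k) :
      ((M a ⊗ₖ (1 : Matrix (Fin m) (Fin m) ℂ)) * U * (σ ⊗ₖ ρ) * Uᴴ *
        ((M a)ᴴ ⊗ₖ (1 : Matrix (Fin m) (Fin m) ℂ)) *
        ((1 : Matrix (Fin d) (Fin d) ℂ) ⊗ₖ L)).trace =
      (U * (σ ⊗ₖ ρ) * Uᴴ * (((M a)ᴴ * M a) ⊗ₖ L)).trace := by
    have h : ((M a)ᴴ * M a) ⊗ₖ L =
        ((M a)ᴴ ⊗ₖ (1 : Matrix (Fin m) (Fin m) ℂ)) *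
          ((1 : Matrix (Fin d) (Fin d) ℂ) ⊗ₖ L) *
          (M a ⊗ₖ (1 : Matrix (Fin m) (Fin m) ℂ)) := by
      simp [← mul_kronecker_mul]
    simp only [h, Matrix.mul_assoc]
    rw [trace_mul_comm]
    simp only [Matrix.mul_assoc]
  simp_rw [term_eq]
  rw [← trace_sum, ← Finset.mul_sum, ← sum_kronecker, hM]
  calc
    (U * (σ ⊗ₖ ρ) * Uᴴ * ((1 : Matrix (Fin d) (Fin d) ℂ) ⊗ₖ L)).trace
        = ((σ ⊗ₖ ρ) * (Uᴴ * (((1 : Matrix (Fin d) (Fin d) ℂ) ⊗ₖ L) * U))).trace := by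
      simp only [Matrix.mul_assoc]
      rw [trace_mul_comm]
      simp only [Matrix.mul_assoc]
    _ = ((σ ⊗ₖ ρ) * ((1 : Matrix (Fin d) (Fin d) ℂ) ⊗ₖ L)).trace := by
      rw [← hcomm.eq, ← Matrix.mul_assoc Uᴴ, hU', Matrix.one_mul]
    _ = σ.trace * (ρ * L).trace := by
      rw [← mul_kronecker_mul, trace_kronecker, Matrix.mul_one]
end
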